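/- Let (X,d) be a metric space, f : X → X a local radial contraction with constant k ∈ (0,1), and γ₀ : [0,1] → X a rectifiable (continuous) path joining x₀ ∈ X to f(x₀). Then for all natural numbers m > n, d(fᵐ(x₀), fⁿ(x₀)) ≤ (kⁿ/(1−k))·l(γ₀); in particular the sequence of iterates (fⁿ(x₀)) is a Cauchy sequence in (X,d). -/

import Mathlib

open Set

/-- The length of a path `γ : ℝ → X`, restricted to `[0,1]`, as the supremum over
finite partitions of the sums of distances between consecutive points. -/
noncomputable def pathLength {X : Type*} [MetricSpace X] (γ : ℝ → X) : ENNReal :=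
  eVariationOn γ (Set.Icc 0 1)

/-- `f` is a local radial contraction with constant `k`. -/
def LocalRadialContraction {X : Type*} [MetricSpace X] (f : X → X) (k : ℝ) : Prop :=
  ∀ x : X, ∃ εx > (0 : ℝ), ∀ y : X, dist x y < εx → dist (f x) (f y) ≤ k * dist x y

theorem LocalRadialContraction.continuous {X : Type*} [MetricSpace X] {f : X → X} {k : ℝ}
    (hk1 : k < 1) (hf : LocalRadialContraction f k) : Continuous f := by
  rw [Metric.continuous_iff]
  intro x ε hε
  obtain ⟨δ, hδ, h⟩ := hf x
  refine ⟨min δ ε, lt_min hδ hε, fun y hy => ?_⟩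
  rw [dist_comm] at hy
  have := h y (hy.trans_le (min_le_left _ _))
  rw [dist_comm]
  have h2 := hy.trans_le (min_le_right _ _)
  nlinarith [dist_nonneg (x := x) (y := y)]

/-- Along a continuous path, each point has a neighbourhood in which `f` contracts distances
to that point. -/
theorem LocalRadialContraction.exists_edist_comp_le {X : Type*} [MetricSpace X] {f : X → X}
    {k : ℝ} (hk0 : 0 ≤ k) (hf : LocalRadialContraction f k) {γ : ℝ → X} {s : Set ℝ}
    (hγ : ContinuousOn γ s) {c : ℝ} (hc : c ∈ s) :
    ∃ δ > 0, ∀ t ∈ s, |t - c| < δ →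
      edist (f (γ c)) (f (γ t)) ≤ ENNReal.ofReal k * edist (γ c) (γ t) := by
  obtain ⟨ε, hε, h⟩ := hf (γ c)
  obtain ⟨δ, hδ, hcont⟩ := Metric.continuousOn_iff.1 hγ c hc ε hε
  refine ⟨δ, hδ, fun t ht htc => ?_⟩
  rw [edist_dist, edist_dist, ← ENNReal.ofReal_mul hk0]
  refine ENNReal.ofReal_le_ofReal (h _ ?_)
  rw [dist_comm]
  exact hcont t ht htc

theorem LocalRadialContraction.edist_comp_le_eVariationOn {X : Type*} [MetricSpace X]
    {f : X → X} {k : ℝ} (hk0 : 0 ≤ k) (hf : LocalRadialContraction f k) {γ : ℝ → X} {a b : ℝ}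
    (hab : a ≤ b) (hγ : ContinuousOn γ (Icc a b)) :
    edist (f (γ a)) (f (γ b)) ≤ ENNReal.ofReal k * eVariationOn γ (Icc a b) := by
  have step : ∀ s t, a ≤ s → s ≤ t →
      edist (f (γ a)) (f (γ s)) ≤ ENNReal.ofReal k * eVariationOn γ (Icc a s) →
      edist (f (γ s)) (f (γ t)) ≤ ENNReal.ofReal k * edist (γ s) (γ t) →
      edist (f (γ a)) (f (γ t)) ≤ ENNReal.ofReal k * eVariationOn γ (Icc a t) := by
    intro s t has hst h₁ h₂
    have hadd := eVariationOn.Icc_add_Icc γ (s := univ) has hst (mem_univ s)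
    simp only [univ_inter] at hadd
    rw [← hadd, mul_add]
    refine (edist_triangle _ (f (γ s)) _).trans (add_le_add h₁ (h₂.trans ?_))
    gcongr
    exact eVariationOn.edist_le γ (left_mem_Icc.2 hst) (right_mem_Icc.2 hst)
  let S : Set ℝ := {t | t ∈ Icc a b ∧
    edist (f (γ a)) (f (γ t)) ≤ ENNReal.ofReal k * eVariationOn γ (Icc a t)}
  have haS : a ∈ S := ⟨left_mem_Icc.2 hab, by simp⟩
  have hS : BddAbove S := ⟨b, fun t ht => ht.1.2⟩
  have hc : sSup S ∈ Icc a b := ⟨le_csSup hS haS, csSup_le ⟨a, haS⟩ fun t ht => ht.1.2⟩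
  obtain ⟨δ, hδ, hloc⟩ := hf.exists_edist_comp_le hk0 hγ hc
  have hcS : sSup S ∈ S := by
    obtain ⟨s, hs, hsc⟩ := exists_lt_of_lt_csSup ⟨a, haS⟩ (sub_lt_self (sSup S) hδ)
    have hle : s ≤ sSup S := le_csSup hS hs
    refine ⟨hc, step s _ hs.1.1 hle hs.2 ?_⟩
    rw [edist_comm, edist_comm (γ s)]
    exact hloc s hs.1 (by rw [abs_lt]; constructor <;> linarith)
  rcases hc.2.eq_or_lt with h | h
  · rw [h] at hcS
    exact hcS.2
  · exfalso
    have h₁ : sSup S < min b (sSup S + δ / 2) := lt_min h (by linarith)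
    have hmem : min b (sSup S + δ / 2) ∈ Icc a b := ⟨hc.1.trans h₁.le, min_le_left _ _⟩
    refine h₁.not_ge (le_csSup hS ⟨hmem, step _ _ hc.1 h₁.le hcS.2 (hloc _ hmem ?_)⟩)
    have := min_le_right b (sSup S + δ / 2)
    rw [abs_lt]
    constructor <;> linarith

theorem LocalRadialContraction.eVariationOn_comp_le {X : Type*} [MetricSpace X]
    {f : X → X} {k : ℝ} (hk0 : 0 ≤ k) (hf : LocalRadialContraction f k) {γ : ℝ → X} {a b : ℝ}
    (hγ : ContinuousOn γ (Icc a b)) :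
    eVariationOn (f ∘ γ) (Icc a b) ≤ ENNReal.ofReal k * eVariationOn γ (Icc a b) := by
  refine iSup_le fun ⟨n, u, hu, hmem⟩ => ?_
  calc ∑ i ∈ Finset.range n, edist ((f ∘ γ) (u (i + 1))) ((f ∘ γ) (u i))
      ≤ ∑ i ∈ Finset.range n, ENNReal.ofReal k * eVariationOn γ (Icc (u i) (u (i + 1))) := by
        refine Finset.sum_le_sum fun i _ => ?_
        rw [edist_comm]
        exact hf.edist_comp_le_eVariationOn hk0 (hu i.le_succ)
          (hγ.mono (Icc_subset_Icc (hmem i).1 (hmem (i + 1)).2))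
    _ = ENNReal.ofReal k * eVariationOn γ (Icc (u 0) (u n)) := by
        rw [← Finset.mul_sum, eVariationOn.sum' γ hu]
    _ ≤ ENNReal.ofReal k * eVariationOn γ (Icc a b) := by
        gcongr
        exact eVariationOn.mono γ (Icc_subset_Icc (hmem 0).1 (hmem n).2)

theorem LocalRadialContraction.eVariationOn_iterate_comp_le {X : Type*} [MetricSpace X]
    {f : X → X} {k : ℝ} (hk0 : 0 ≤ k) (hk1 : k < 1) (hf : LocalRadialContraction f k)
    {γ : ℝ → X} {a b : ℝ} (hγ : ContinuousOn γ (Icc a b)) (n : ℕ) :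
    eVariationOn (f^[n] ∘ γ) (Icc a b) ≤ ENNReal.ofReal k ^ n * eVariationOn γ (Icc a b) := by
  induction n with
  | zero => simp
  | succ n ih =>
    rw [Function.iterate_succ', Function.comp_assoc, pow_succ', mul_assoc]
    refine (hf.eVariationOn_comp_le hk0
      (((hf.continuous hk1).iterate n).comp_continuousOn hγ)).trans ?_
    gcongr

theorem iterates_cauchy_of_local_radial_contraction
    {X : Type*} [MetricSpace X] (f : X → X) (k : ℝ)
    (hk0 : 0 < k) (hk1 : k < 1) (hf : LocalRadialContraction f k)
    (x₀ : X) (γ₀ : ℝ → X) (hγ : ContinuousOn γ₀ (Set.Icc 0 1))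
    (hγ0 : γ₀ 0 = x₀) (hγ1 : γ₀ 1 = f x₀) (hrect : pathLength γ₀ ≠ ⊤) :
    (∀ m n : ℕ, n < m →
      dist (f^[m] x₀) (f^[n] x₀) ≤ k ^ n / (1 - k) * (pathLength γ₀).toReal) ∧
      CauchySeq (fun n => f^[n] x₀) := by
  have hstep : ∀ n, dist (f^[n] x₀) (f^[n + 1] x₀) ≤ (pathLength γ₀).toReal * k ^ n := by
    intro n
    have h := (eVariationOn.edist_le (f^[n] ∘ γ₀) (left_mem_Icc.2 zero_le_one)
      (right_mem_Icc.2 zero_le_one)).trans (hf.eVariationOn_iterate_comp_le hk0.le hk1 hγ n)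
    rw [Function.comp_apply, Function.comp_apply, hγ0, hγ1, ← Function.iterate_succ_apply] at h
    rw [dist_edist]
    refine (ENNReal.toReal_mono (ENNReal.mul_ne_top (by simp) hrect) h).trans_eq ?_
    rw [ENNReal.toReal_mul, ENNReal.toReal_pow, ENNReal.toReal_ofReal hk0.le, mul_comm]
  refine ⟨fun m n hnm => ?_, cauchySeq_of_le_geometric k _ hk1 hstep⟩
  rw [dist_comm]
  refine (dist_le_Ico_sum_of_dist_le (f := fun n => f^[n] x₀) hnm.le
    fun _ _ => hstep _).trans ?_
  rw [← Finset.mul_sum, mul_comm]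
  gcongr
  exact geom_sum_Ico_le_of_lt_one hk0.le hk1
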